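/- Let D be a bounded ℂ-convex domain in ℂ^{n+m} that is strictly ℂ-convex, let π : ℂ^{n+m} → ℂⁿ be the projection onto the first n coordinates, and let z be a boundary point of the shadow π(D). Then there is exactly one w ∈ ℂᵐ with (z,w) ∈ cl(D); that is, ({z} × ℂᵐ) ∩ cl(D) is a singleton. -/

import Mathlib

open Set Topology Filter

noncomputable section

variable {E : Type*} [NormedAddCommGroup E] [NormedSpace ℂ E]

/-- A complex affine line in a complex normed space. -/
def IsComplexAffineLine (L : Set E) : Prop :=
  ∃ a v : E, v ≠ 0 ∧ L = {x | ∃ t : ℂ, x = a + t • v}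

/-- A complex affine hyperplane: a level set of a nonzero continuous ℂ-linear functional. -/
def IsComplexAffineHyperplane (H : Set E) : Prop :=
  ∃ (f : E →L[ℂ] ℂ) (c : ℂ), f ≠ 0 ∧ H = {x | f x = c}

/-- A domain `D` is ℂ-convex if its intersection with every complex affine line meeting it
is connected and simply connected. -/
def IsCConvex (D : Set E) : Prop :=
  ∀ L : Set E, IsComplexAffineLine L → (L ∩ D).Nonempty →
    IsConnected (L ∩ D) ∧ SimplyConnectedSpace ↥(L ∩ D)

/-- `p` is an extreme ℂ-convex boundary point of `D`. -/
def ExtremeCConvexAt (D : Set E) (p : E) : Prop :=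
  ∃ H : Set E, IsComplexAffineHyperplane H ∧ p ∈ H ∧
    ∃ U : Set E, IsOpen U ∧ p ∈ U ∧ H ∩ closure D ∩ U = {p}

/-- `p` is a globally extreme ℂ-convex boundary point of `D`. -/
def GloballyExtremeCConvexAt (D : Set E) (p : E) : Prop :=
  ∃ H : Set E, IsComplexAffineHyperplane H ∧ p ∈ H ∧ H ∩ closure D = {p}

/-- `p` is a strictly ℂ-convex boundary point of `D`. -/
def StrictlyCConvexAt (D : Set E) (p : E) : Prop :=
  ∃ U : Set E, IsOpen U ∧ p ∈ U ∧
    ∀ H : Set E, IsComplexAffineHyperplane H → p ∈ H → H ∩ D = ∅ →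
      U ∩ closure D ∩ H = {p}

/-- `p` is a globally strictly ℂ-convex boundary point of `D`. -/
def GloballyStrictlyCConvexAt (D : Set E) (p : E) : Prop :=
  ∀ H : Set E, IsComplexAffineHyperplane H → p ∈ H → H ∩ D = ∅ →
    closure D ∩ H = {p}

/-- `p` is a normal boundary point of `D`. -/
def NormalAt (D : Set E) (p : E) : Prop :=
  ∀ U : Set E, IsOpen U → p ∈ U →
    ∃ V : Set E, IsOpen V ∧ p ∈ V ∧ V ⊆ U ∧
      ∀ x ∈ V ∩ D, ∀ y ∈ V ∩ D, JoinedIn (U ∩ D) x y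

/-- `p` is a strongly normal boundary point of `D`. -/
def StronglyNormalAt (D : Set E) (p : E) : Prop :=
  ∀ U : Set E, IsOpen U → p ∈ U →
    ∃ V : Set E, IsOpen V ∧ p ∈ V ∧ V ⊆ U ∧ IsConnected (V ∩ D)

/-- The Wirtinger-type derivative `∂ρ(z)(X) = (dρ(z)(X) - i·dρ(z)(iX))/2` of a real-valued
function; for `ρ` real-valued this is the complex-linear part of the real differential, so that
`∂ρ(z)(X) = Σ_j (∂ρ/∂z_j)(z)·X_j` in coordinates. -/
def wirtingerDeriv (ρ : E → ℝ) (z X : E) : ℂ :=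
  (((fderiv ℝ ρ z X : ℝ) : ℂ) - Complex.I * ((fderiv ℝ ρ z (Complex.I • X) : ℝ) : ℂ)) / 2

/-- The second (real) derivative `D²ρ(z)(X,Y)`. -/
def secondDerivAt (ρ : E → ℝ) (z X Y : E) : ℝ :=
  fderiv ℝ (fderiv ℝ ρ) z X Y

/-- `U`, `ρ`, `c` witness that the bounded domain `D` is a `C^k`-smooth strongly linearly
convex domain. -/
def IsSLCDefiningData (k : ℕ∞) (D U : Set E) (ρ : E → ℝ) (c : ℝ) : Prop :=
  IsOpen U ∧ frontier D ⊆ U ∧ ContDiffOn ℝ k ρ U ∧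
  frontier D = {z ∈ U | ρ z = 0} ∧ D ∩ U = {z ∈ U | ρ z < 0} ∧
  (∀ z ∈ U, fderiv ℝ ρ z ≠ 0) ∧ 0 < c ∧
  (∀ z ∈ frontier D, ∀ X : E, wirtingerDeriv ρ z X = 0 →
    c * ‖X‖ ^ 2 ≤ secondDerivAt ρ z X X)

end

/-- Every parametrized complex line meeting `D` meets it in a simply connected set of
parameters. -/
def LineSimplyConnected {E : Type*} [AddCommGroup E] [Module ℂ E] (D : Set E) : Prop :=
  ∀ a v : E, {t : ℂ | a + t • v ∈ D}.Nonempty → IsSimplyConnected {t : ℂ | a + t • v ∈ D}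

theorem IsPreconnected.sub_eq_sub_of_exp_eq {X : Type*} [TopologicalSpace X] {s : Set X}
    (hs : IsPreconnected s) {u v : X → ℂ} (hu : ContinuousOn u s) (hv : ContinuousOn v s)
    (huv : ∀ x ∈ s, Complex.exp (u x) = Complex.exp (v x)) {x y : X} (hx : x ∈ s) (hy : y ∈ s) :
    u x - v x = u y - v y := by
  have key : EqOn u (fun z => v z + (u x - v x)) s := by
    refine Complex.isCoveringMap_exp.eqOn_of_comp_eqOn hs hu (hv.add continuousOn_const)
      (fun z hz => ?_) hx (by ring)
    apply Subtype.ext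
    simp [Complex.exp_add, Complex.exp_sub, huv z hz, huv x hx]
  have := key hy
  simp only at this
  rw [this]; ring

/-- Logarithms along the complex lines through a base point `p` depend continuously on the
endpoint and on the parameter. -/
theorem exists_log_branch_of_base_point {Z G : Type*} [TopologicalSpace Z]
    [NormedAddCommGroup G] [NormedSpace ℂ G] {Y : Set (Z × G)} (hY : IsOpen Y)
    (hconv : ∀ ζ, LineSimplyConnected {x | (ζ, x) ∈ Y}) {f : G → ℂ} (hf : Continuous f)
    (hf0 : ∀ y ∈ Y, f y.2 ≠ 0) (p : G) :
    ∃ Λ : Z × G → ℂ, ∀ y ∈ Y, (y.1, p) ∈ Y →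
      ContinuousAt Λ y ∧ Complex.exp (Λ y) = f y.2 := by
  let S : Z × G → Set ℂ := fun y => {t | (y.1, p + t • (y.2 - p)) ∈ Y}
  have h0 : ∀ y, (y.1, p) ∈ Y → (0 : ℂ) ∈ S y := fun y hy => by simpa [S] using hy
  have h1 : ∀ y, y ∈ Y → (1 : ℂ) ∈ S y := fun y hy => by simpa [S] using hy
  have hSc : ∀ y, (y.1, p) ∈ Y → IsSimplyConnected (S y) := fun y hy =>
    hconv y.1 p (y.2 - p) ⟨0, h0 y hy⟩
  have hex : ∀ y, ∃ g : ℂ → ℂ, (y.1, p) ∈ Y → ContinuousOn g (S y) ∧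
      (∀ t ∈ S y, Complex.exp (g t) = f (p + t • (y.2 - p))) ∧ g 0 = Complex.log (f p) := by
    intro y
    by_cases hy : (y.1, p) ∈ Y
    · have hSo : IsOpen (S y) := hY.preimage (by fun_prop)
      obtain ⟨g, hgc, hge⟩ := Complex.exists_continuousOn_eqOn_exp_comp (hSc y hy) hSo
        (g := fun t => f (p + t • (y.2 - p))) (by fun_prop) (by
          rintro ⟨t, ht, h⟩
          exact hf0 _ ht h)
      refine ⟨fun t => g t + (Complex.log (f p) - g 0), fun _ => ⟨by fun_prop, ?_, by simp⟩⟩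
      intro t ht
      have e0 : Complex.exp (g 0) = f p := by simpa using hge (h0 y hy)
      have et : Complex.exp (g t) = f (p + t • (y.2 - p)) := hge ht
      have hp : f p ≠ 0 := hf0 _ hy
      rw [Complex.exp_add, Complex.exp_sub, e0, et, Complex.exp_log hp, div_self hp, mul_one]
    · exact ⟨0, fun h => absurd h hy⟩
  choose g hg using hex
  refine ⟨fun y => g y 1, fun y₀ hy₀ hp₀ => ⟨?_, ?_⟩⟩
  swap
  · simpa using (hg y₀ hp₀).2.1 1 (h1 y₀ hy₀)
  obtain ⟨γ, hγ⟩ := (hSc y₀ hp₀).isPathConnected.joinedIn 0 (h0 y₀ hp₀) 1 (h1 y₀ hy₀)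
  let c : Z × G → unitInterval → G := fun y s => p + γ s • (y.2 - p)
  have hc : Continuous fun q : (Z × G) × unitInterval => c q.1 q.2 := by
    simp only [c]; fun_prop
  have hne : ∀ s, f (c y₀ s) ≠ 0 := fun s => hf0 _ (hγ s)
  have hev : ∀ᶠ y in 𝓝 y₀, ∀ s ∈ (univ : Set unitInterval),
      (y.1, c y s) ∈ Y ∧ f (c y s) / f (c y₀ s) ∈ Complex.slitPlane := by
    refine isCompact_univ.eventually_forall_of_forall_eventually fun s _ => ?_
    refine Filter.Eventually.and ?_ ?_
    · refine ContinuousAt.eventually_mem (f := fun q : (Z × G) × unitInterval =>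
        (q.1.1, c q.1 q.2)) (by fun_prop) (hY.mem_nhds (hγ s))
    · refine ContinuousAt.eventually_mem (f := fun q : (Z × G) × unitInterval =>
        f (c q.1 q.2) / f (c y₀ q.2)) ?_ (Complex.isOpen_slitPlane.mem_nhds ?_)
      · refine ContinuousAt.div (by fun_prop) ?_ (hne s)
        have : Continuous fun q : (Z × G) × unitInterval => c y₀ q.2 := by
          simp only [c]; fun_prop
        fun_prop
      · simp [div_self (hne s)]
  have hloc : (fun y => g y 1) =ᶠ[𝓝 y₀]
      fun y => g y₀ 1 + Complex.log (f y.2 / f y₀.2) := by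
    filter_upwards [hev] with y hy
    have hpy : (y.1, p) ∈ Y := by simpa [c] using (hy 0 trivial).1
    have hyS : ∀ s, γ s ∈ S y := fun s => (hy s trivial).1
    have hcy : ∀ y, Continuous (c y) := fun y => by simp only [c]; fun_prop
    have := isPreconnected_univ.sub_eq_sub_of_exp_eq (X := unitInterval)
      (u := fun s => g y (γ s))
      (v := fun s => g y₀ (γ s) + Complex.log (f (c y s) / f (c y₀ s)))
      ((hg y hpy).1.comp γ.continuous.continuousOn fun s _ => hyS s)
      (((hg y₀ hp₀).1.comp γ.continuous.continuousOn fun s _ => hγ s).add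
        (ContinuousOn.clog
          (((hf.comp (hcy y)).div (hf.comp (hcy y₀)) hne).continuousOn)
          fun s hs => (hy s hs).2))
      (fun s _ => by
        have e1 : Complex.exp (g y (γ s)) = f (c y s) := (hg y hpy).2.1 _ (hyS s)
        have e2 : Complex.exp (g y₀ (γ s)) = f (c y₀ s) := (hg y₀ hp₀).2.1 _ (hγ s)
        have e3 : f (c y s) ≠ 0 := hf0 _ (hyS s)
        rw [Complex.exp_add, e1, e2, Complex.exp_log (div_ne_zero e3 (hne s)),
          mul_div_cancel₀ _ (hne s)])
      (mem_univ 0) (mem_univ 1)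
    have hfp : f p ≠ 0 := hf0 _ hp₀
    simp [c, (hg y hpy).2.2, (hg y₀ hp₀).2.2, div_self hfp] at this
    linear_combination -this
  refine ContinuousAt.congr ?_ hloc.symm
  have hfy : f y₀.2 ≠ 0 := hf0 _ hy₀
  refine continuousAt_const.add (ContinuousAt.clog ?_ (by simp [div_self hfy]))
  exact ContinuousAt.div_const (by fun_prop) _

/-- Averaging the local logarithms with a partition of unity gives a global logarithm of `f` up to
a factor depending on the parameter only. -/
theorem exists_log_branch_up_to_factor {Z G : Type*} [TopologicalSpace Z] [T2Space Z]
    [ParacompactSpace Z]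
    [NormedAddCommGroup G] [NormedSpace ℂ G] {Y : Set (Z × G)} (hY : IsOpen Y)
    (hconv : ∀ ζ, LineSimplyConnected {x | (ζ, x) ∈ Y}) (hne : ∀ ζ, ∃ x, (ζ, x) ∈ Y)
    {f : G → ℂ} (hf : Continuous f) (hf0 : ∀ y ∈ Y, f y.2 ≠ 0) :
    ∃ (Ψ : Z × G → ℂ) (h : Z → ℂ), Continuous h ∧ (∀ ζ, h ζ ≠ 0) ∧
      ∀ y ∈ Y, ContinuousAt Ψ y ∧ Complex.exp (Ψ y) = h y.1 * f y.2 := by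
  choose Λ hΛ using exists_log_branch_of_base_point hY hconv hf hf0
  let U : G → Set Z := fun p => {ζ | (ζ, p) ∈ Y}
  have hU : ∀ p, IsOpen (U p) := fun p => hY.preimage (by fun_prop)
  obtain ⟨φ, hφ⟩ := PartitionOfUnity.exists_isSubordinate isClosed_univ U hU
    (fun ζ _ => mem_iUnion.2 (hne ζ))
  have hφU : ∀ {p ζ}, φ p ζ ≠ 0 → (ζ, p) ∈ Y := fun {p ζ} h =>
    hφ p (subset_tsupport _ h)
  let Ψ : Z × G → ℂ := fun y => ∑ᶠ p, φ p y.1 • Λ p y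
  have hΨ : ∀ y ∈ Y, ContinuousAt Ψ y := by
    intro y hy
    obtain ⟨I, N, hN, hNU, hI⟩ := PartitionOfUnity.exists_finset_nhds_support_subset hφ hU y.1
    have hloc : Ψ =ᶠ[𝓝 y] fun y => ∑ p ∈ I, φ p y.1 • Λ p y := by
      filter_upwards [continuous_fst.continuousAt.preimage_mem_nhds hN] with y' hy'
      refine finsum_eq_sum_of_support_subset _ fun p hp => hI _ hy' ?_
      exact fun h => hp (by simp [h])
    refine ContinuousAt.congr ?_ hloc.symm
    refine tendsto_finsetSum _ fun p hp => ?_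
    have hyp : (y.1, p) ∈ Y := by
      have := hNU (mem_of_mem_nhds hN)
      simp only [mem_iInter] at this
      exact this p hp
    have hc := (hΛ p y hy hyp).1
    exact ((φ p).continuous.comp continuous_fst).continuousAt.smul hc
  have hdiff : ∀ ζ x x', (ζ, x) ∈ Y → (ζ, x') ∈ Y →
      Complex.exp (Ψ (ζ, x)) * f x' = Complex.exp (Ψ (ζ, x')) * f x := by
    intro ζ x x' hx hx'
    obtain ⟨q, hq⟩ := φ.exists_pos (mem_univ ζ)
    have hqY : (ζ, q) ∈ Y := hφU hq.ne'
    have hind : ∀ p, (ζ, p) ∈ Y → Λ p (ζ, x) = Λ p (ζ, x') + (Λ q (ζ, x) - Λ q (ζ, x')) := by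
      intro p hp
      have m0 : (0 : ℂ) ∈ {t : ℂ | x + t • (x' - x) ∈ {x | (ζ, x) ∈ Y}} := by simpa using hx
      have m1 : (1 : ℂ) ∈ {t : ℂ | x + t • (x' - x) ∈ {x | (ζ, x) ∈ Y}} := by simpa using hx'
      have hcont : ∀ p, (ζ, p) ∈ Y → ContinuousOn (fun t : ℂ => Λ p (ζ, x + t • (x' - x)))
          {t : ℂ | x + t • (x' - x) ∈ {x | (ζ, x) ∈ Y}} := fun p hp t ht =>
        (ContinuousAt.comp (f := fun t : ℂ => (ζ, x + t • (x' - x))) (hΛ p _ ht hp).1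
          (by fun_prop)).continuousWithinAt
      have := (hconv ζ x (x' - x) ⟨0, m0⟩).isPathConnected.isConnected.isPreconnected
        |>.sub_eq_sub_of_exp_eq (hcont p hp) (hcont q hqY)
        (fun t ht => by rw [(hΛ p _ ht hp).2, (hΛ q _ ht hqY).2]) m0 m1
      simp at this
      linear_combination this
    have hsum : Ψ (ζ, x) = Ψ (ζ, x') + (Λ q (ζ, x) - Λ q (ζ, x')) := by
      have hfin : (Function.support fun p => φ p ζ).Finite := φ.locallyFinite.point_finite ζ
      have hs : ∀ x, Ψ (ζ, x) = ∑ p ∈ hfin.toFinset, φ p ζ • Λ p (ζ, x) := fun x =>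
        finsum_eq_sum_of_support_subset _ fun p hp => by
          simp only [Finite.coe_toFinset]
          exact fun h => hp (by simp [h])
      have h1 : ∑ p ∈ hfin.toFinset, φ p ζ = 1 := by
        rw [← φ.sum_eq_one (mem_univ ζ)]
        exact (finsum_eq_sum_of_support_subset _ (by simp)).symm
      have h2 : ∑ p ∈ hfin.toFinset, φ p ζ • Λ p (ζ, x) = ∑ p ∈ hfin.toFinset,
          (φ p ζ • Λ p (ζ, x') + φ p ζ • (Λ q (ζ, x) - Λ q (ζ, x'))) :=
        Finset.sum_congr rfl fun p hp => by
          rw [hind p (hφU (by simpa using hp)), smul_add]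
      rw [hs, hs, h2, Finset.sum_add_distrib, ← Finset.sum_smul, h1, one_smul]
    rw [hsum, Complex.exp_add, Complex.exp_sub, (hΛ q _ hx hqY).2, (hΛ q _ hx' hqY).2]
    have := hf0 _ hx'
    simp only at this ⊢
    field_simp
  choose σ hσ using hne
  have hval : ∀ y ∈ Y, Complex.exp (Ψ (y.1, σ y.1)) / f (σ y.1) = Complex.exp (Ψ y) / f y.2 :=
    fun y hy => by
      rw [div_eq_div_iff (hf0 _ (hσ y.1)) (hf0 _ hy)]
      exact hdiff _ _ _ (hσ _) hy
  refine ⟨Ψ, fun ζ => Complex.exp (Ψ (ζ, σ ζ)) / f (σ ζ), ?_, fun ζ =>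
    div_ne_zero (Complex.exp_ne_zero _) (hf0 _ (hσ ζ)), fun y hy => ⟨hΨ y hy, ?_⟩⟩
  · refine continuous_iff_continuousAt.2 fun ζ₀ => ?_
    have hloc : (fun ζ => Complex.exp (Ψ (ζ, σ ζ)) / f (σ ζ)) =ᶠ[𝓝 ζ₀]
        fun ζ => Complex.exp (Ψ (ζ, σ ζ₀)) / f (σ ζ₀) := by
      filter_upwards [(hU (σ ζ₀)).mem_nhds (hσ ζ₀)] with ζ hζ
      exact hval (ζ, σ ζ₀) hζ
    refine ContinuousAt.congr ?_ hloc.symm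
    have : ContinuousAt (fun ζ => Ψ (ζ, σ ζ₀)) ζ₀ :=
      ContinuousAt.comp (f := fun ζ => (ζ, σ ζ₀)) (hΨ _ (hσ ζ₀)) (by fun_prop)
    exact this.cexp.div_const _
  · simp only
    rw [hval y hy, div_mul_cancel₀ _ (hf0 _ hy)]

theorem exists_log_branch {G : Type*}
    [NormedAddCommGroup G] [NormedSpace ℂ G] {Y : Set (ℂ × G)} (hY : IsOpen Y)
    (hconv : ∀ ζ, LineSimplyConnected {x | (ζ, x) ∈ Y}) (hne : ∀ ζ, ∃ x, (ζ, x) ∈ Y)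
    {f : G → ℂ} (hf : Continuous f) (hf0 : ∀ y ∈ Y, f y.2 ≠ 0) :
    ∃ Λ : ℂ × G → ℂ, ∀ y ∈ Y, ContinuousAt Λ y ∧ Complex.exp (Λ y) = f y.2 := by
  obtain ⟨Ψ, h, hc, h0, hΨ⟩ := exists_log_branch_up_to_factor hY hconv hne hf hf0
  have huniv : IsSimplyConnected (univ : Set ℂ) :=
    (Homeomorph.Set.univ ℂ).toHomotopyEquiv.simplyConnectedSpace
  obtain ⟨k, hk, hke⟩ := Complex.exists_continuousOn_eqOn_exp_comp huniv isOpen_univ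
    hc.continuousOn (by rintro ⟨ζ, -, hζ⟩; exact h0 ζ hζ)
  rw [continuousOn_univ] at hk
  refine ⟨fun y => Ψ y - k y.1, fun y hy => ⟨(hΨ y hy).1.sub (by fun_prop), ?_⟩⟩
  have : Complex.exp (k y.1) = h y.1 := hke (mem_univ _)
  rw [Complex.exp_sub, (hΨ y hy).2, this, mul_div_cancel_left₀ _ (h0 _)]

theorem not_exists_log_inv_circle (a : ℂ → ℂ) (c : ℂ)
    (ha : ∀ z : ℂ, ‖z‖ = 1 → ContinuousAt a z ∧ Complex.exp (a z) = z⁻¹ * c) : False := by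
  have hn : ∀ θ : ℝ, ‖Complex.exp (θ * Complex.I)‖ = 1 := Complex.norm_exp_ofReal_mul_I
  have hc0 : c ≠ 0 := by
    rintro rfl
    have := (ha 1 (by simp)).2
    simp at this
  have := isPreconnected_univ.sub_eq_sub_of_exp_eq (X := ℝ)
    (u := fun θ : ℝ => a (Complex.exp (θ * Complex.I)) + θ * Complex.I)
    (v := fun _ => a 1)
    (continuousOn_of_forall_continuousAt fun θ _ => by
      refine ContinuousAt.add ?_ (by fun_prop)
      exact ContinuousAt.comp (f := fun θ : ℝ => Complex.exp (θ * Complex.I))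
        (ha _ (hn θ)).1 (by fun_prop))
    continuousOn_const
    (fun θ _ => by
      rw [Complex.exp_add, (ha _ (hn θ)).2, (ha 1 (by simp)).2]
      field_simp [Complex.exp_ne_zero])
    (mem_univ 0) (mem_univ (2 * Real.pi))
  simp [Complex.exp_two_pi_mul_I, Real.pi_ne_zero] at this

/-- The only codimension in which a subspace missing an open ℂ-convex set can be maximal is one:
otherwise a disc of linear subspaces whose boundary circle is constant would carry a continuous
logarithm. -/
theorem mem_sup_span_of_maximal {E : Type*} [NormedAddCommGroup E] [NormedSpace ℂ E]
    {D : Set E} (hD : IsOpen D) (hconv : LineSimplyConnected D) {W : Submodule ℂ E}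
    (hW : ∀ x ∈ W, x ∉ D) (hmax : ∀ W' : Submodule ℂ E, W < W' → ∃ x ∈ W', x ∈ D)
    {u : E} (hu : u ∉ W) (v : E) : v ∈ W ⊔ Submodule.span ℂ {u} := by
  by_contra hv
  let η : ℂ → ℂ := fun ζ => ((max 0 (1 - ‖ζ‖) : ℝ) : ℂ)
  have hη : Continuous η := by simp only [η]; fun_prop
  let e : ℂ → E := fun ζ => ζ • u + η ζ • v
  have he : Continuous e := by simp only [e]; fun_prop
  have heW : ∀ ζ, e ζ ∉ W := by
    intro ζ h
    by_cases h0 : η ζ = 0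
    · have hζ : ζ ≠ 0 := by
        rintro rfl
        simp [η] at h0
      simp only [e, h0, zero_smul, add_zero] at h
      exact hu ((W.smul_mem_iff hζ).1 h)
    · have h1 : ζ • u ∈ W ⊔ Submodule.span ℂ {u} :=
        Submodule.mem_sup_right (Submodule.smul_mem _ _ (Submodule.mem_span_singleton_self u))
      have h2 : η ζ • v ∈ W ⊔ Submodule.span ℂ {u} := by
        have := Submodule.sub_mem _ (Submodule.mem_sup_left (T := Submodule.span ℂ {u}) h) h1
        simpa [e] using this
      exact hv ((Submodule.smul_mem_iff _ h0).1 h2)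
  let Y : Set (ℂ × (W × ℂ)) := {y | (y.2.1 : E) + y.2.2 • e y.1 ∈ D}
  have hY : IsOpen Y := hD.preimage (by fun_prop)
  have hYconv : ∀ ζ, LineSimplyConnected {x | (ζ, x) ∈ Y} := by
    intro ζ a b
    have : {t : ℂ | a + t • b ∈ {x | (ζ, x) ∈ Y}} =
        {t : ℂ | ((a.1 : E) + a.2 • e ζ) + t • ((b.1 : E) + b.2 • e ζ) ∈ D} := by
      ext t
      simp only [Y, mem_ofPred_eq, Prod.fst_add, Prod.snd_add, Prod.smul_fst, Prod.smul_snd,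
        Submodule.coe_add, Submodule.coe_smul, smul_eq_mul]
      rw [iff_iff_eq]
      congr 1
      module
    rw [this]
    exact hconv _ _
  have hYne : ∀ ζ, ∃ x, (ζ, x) ∈ Y := by
    intro ζ
    obtain ⟨x, hx, hxD⟩ := hmax (W ⊔ Submodule.span ℂ {e ζ})
      (by simpa using heW ζ)
    obtain ⟨w, hw, z, hz, rfl⟩ := Submodule.mem_sup.1 hx
    obtain ⟨t, rfl⟩ := Submodule.mem_span_singleton.1 hz
    exact ⟨(⟨w, hw⟩, t), hxD⟩
  obtain ⟨Λ, hΛ⟩ := exists_log_branch hY hYconv hYne (f := fun x => x.2) continuous_snd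
    (by
      rintro ⟨ζ, w, t⟩ hy (rfl : t = 0)
      exact hW w w.2 (by simpa [Y] using hy))
  obtain ⟨⟨w, t⟩, hwt⟩ := hYne 1
  refine not_exists_log_inv_circle (fun z => Λ (z, (w, z⁻¹ * t))) t fun z hz => ?_
  have hz0 : z ≠ 0 := by
    rintro rfl
    simp at hz
  have hmem : (z, (w, z⁻¹ * t)) ∈ Y := by
    have : (z⁻¹ * t) • e z = t • e 1 := by
      simp only [e, η, hz, norm_one, sub_self, max_self, Complex.ofReal_zero, zero_smul,
        add_zero, smul_smul, mul_one]
      congr 1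
      field_simp
    simp only [Y, mem_ofPred_eq, this]
    exact hwt
  refine ⟨?_, (hΛ _ hmem).2⟩
  refine ContinuousAt.comp (f := fun z : ℂ => (z, (w, z⁻¹ * t))) (hΛ _ hmem).1 ?_
  have : ContinuousAt (fun z : ℂ => z⁻¹) z := continuousAt_inv₀ hz0
  fun_prop

/-- A linear subspace missing a nonempty open ℂ-convex set lies in the kernel of a functional
without zeros on that set. -/
theorem LineSimplyConnected.exists_functional_ne_zero {E : Type*} [NormedAddCommGroup E]
    [NormedSpace ℂ E] [FiniteDimensional ℂ E]
    {D : Set E} (hD : IsOpen D) (hne : D.Nonempty) (hconv : LineSimplyConnected D)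
    {W₀ : Submodule ℂ E} (hW₀ : ∀ x ∈ W₀, x ∉ D) :
    ∃ f : E →L[ℂ] ℂ, f ≠ 0 ∧ (∀ x ∈ W₀, f x = 0) ∧ ∀ x ∈ D, f x ≠ 0 := by
  obtain ⟨W, ⟨hW₀W, hW⟩, hmin⟩ := (wellFounded_gt (α := Submodule ℂ E)).has_min
    {W | W₀ ≤ W ∧ ∀ x ∈ W, x ∉ D} ⟨W₀, le_rfl, hW₀⟩
  have hmax : ∀ W' : Submodule ℂ E, W < W' → ∃ x ∈ W', x ∈ D := by
    intro W' hlt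
    by_contra! h
    exact hmin W' ⟨hW₀W.trans hlt.le, h⟩ hlt
  obtain ⟨u, hu⟩ := hne
  have huW : u ∉ W := fun h => hW u h hu
  obtain ⟨f, hfu, hWf⟩ := Submodule.exists_le_ker_of_notMem huW
  refine ⟨LinearMap.toContinuousLinearMap f, fun h => hfu ?_, fun x hx => hWf (hW₀W hx),
    fun x hx hfx => ?_⟩
  · exact DFunLike.congr_fun h u
  obtain ⟨w, hw, z, hz, rfl⟩ :=
    Submodule.mem_sup.1 (mem_sup_span_of_maximal hD hconv hW hmax huW x)
  obtain ⟨t, rfl⟩ := Submodule.mem_span_singleton.1 hz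
  have hfw : f w = 0 := hWf hw
  have ht : t = 0 := by simpa [hfw, hfu] using hfx
  subst ht
  exact hW w hw (by simpa using hx)

theorem IsCConvex.lineSimplyConnected {E : Type*} [NormedAddCommGroup E] [NormedSpace ℂ E]
    {D : Set E} (h : IsCConvex D) : LineSimplyConnected D := by
  intro a v hne
  rcases eq_or_ne v 0 with rfl | hv
  · have : {t : ℂ | a + t • (0 : E) ∈ D} = univ := by
      obtain ⟨t, ht⟩ := hne
      refine eq_univ_of_forall fun s => ?_
      simpa using ht
    rw [this]
    exact (Homeomorph.Set.univ ℂ).toHomotopyEquiv.simplyConnectedSpace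
  · obtain ⟨t, ht⟩ := hne
    have hL := (h {x | ∃ t : ℂ, x = a + t • v} ⟨a, v, hv, rfl⟩ ⟨_, ⟨t, rfl⟩, ht⟩).2
    have hemb : IsEmbedding fun t : ℂ => a + t • v :=
      (Homeomorph.addLeft a).isEmbedding.comp (isClosedEmbedding_smul_left hv).isEmbedding
    rw [← hemb.isSimplyConnected_image]
    convert hL using 1
    have : (fun t : ℂ => a + t • v) '' {t : ℂ | a + t • v ∈ D} =
        {x | ∃ t : ℂ, x = a + t • v} ∩ D := by
      ext x
      constructor
      · rintro ⟨t, ht, rfl⟩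
        exact ⟨⟨t, rfl⟩, ht⟩
      · rintro ⟨⟨t, rfl⟩, ht⟩
        exact ⟨t, ht, rfl⟩
    rw [this]
    rfl

/-- Two points of `closure D` on a complex line cannot be separated near the first one: at every
prescribed small parameter distance there is a further point of `closure D` on that line. -/
theorem LineSimplyConnected.exists_norm_eq_mem_closure {E : Type*} [NormedAddCommGroup E]
    [NormedSpace ℂ E] {D : Set E} (hconv : LineSimplyConnected D) {p q : E}
    (hp : p ∈ closure D) (hq : q ∈ closure D) {ε : ℝ} (hε0 : 0 ≤ ε) (hε1 : ε ≤ 1) :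
    ∃ t : ℂ, ‖t‖ = ε ∧ p + t • (q - p) ∈ closure D := by
  obtain ⟨a, haD, ha⟩ := mem_closure_iff_seq_limit.1 hp
  obtain ⟨b, hbD, hb⟩ := mem_closure_iff_seq_limit.1 hq
  have hex : ∀ k, ∃ t : ℂ, t ∈ Metric.sphere (0 : ℂ) ε ∧ a k + t • (b k - a k) ∈ D := by
    intro k
    have m0 : (0 : ℂ) ∈ {t : ℂ | a k + t • (b k - a k) ∈ D} := by simpa using haD k
    have m1 : (1 : ℂ) ∈ {t : ℂ | a k + t • (b k - a k) ∈ D} := by simpa using hbD k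
    have hpre := (hconv _ _ ⟨0, m0⟩).isPathConnected.isConnected.isPreconnected
    obtain ⟨t, ht, hte⟩ := hpre.intermediate_value m0 m1 continuous_norm.continuousOn
      (show ε ∈ Icc ‖(0 : ℂ)‖ ‖(1 : ℂ)‖ by simpa using ⟨hε0, hε1⟩)
    exact ⟨t, by simpa using hte, ht⟩
  choose t ht htD using hex
  obtain ⟨t₀, ht₀, φ, hφ, hlim⟩ := (isCompact_sphere (0 : ℂ) ε).tendsto_subseq ht
  refine ⟨t₀, by simpa using ht₀, ?_⟩
  have ha' := ha.comp hφ.tendsto_atTop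
  have hb' := hb.comp hφ.tendsto_atTop
  exact mem_closure_of_tendsto (ha'.add (hlim.smul (hb'.sub ha')))
    (Eventually.of_forall fun k => htD (φ k))

/-- Let `D` be a bounded ℂ-convex domain in `ℂ^{n+m} = ℂⁿ × ℂᵐ` that is strictly ℂ-convex,
let `π = Prod.fst` be the projection onto the first `n` coordinates, and let `z` be a
boundary point of the shadow `π(D)`. Then there is exactly one `w ∈ ℂᵐ` with
`(z,w) ∈ cl(D)`. -/
theorem shadow_fiber_unique {n m : ℕ}
    (D : Set (EuclideanSpace ℂ (Fin n) × EuclideanSpace ℂ (Fin m)))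
    (hOpen : IsOpen D) (hConn : IsConnected D) (hBdd : Bornology.IsBounded D)
    (hCC : IsCConvex D)
    (hStrict : ∀ q ∈ frontier D, StrictlyCConvexAt D q)
    (z : EuclideanSpace ℂ (Fin n)) (hz : z ∈ frontier (Prod.fst '' D)) :
    ∃! w : EuclideanSpace ℂ (Fin m), (z, w) ∈ closure D := by
  have hLSC : LineSimplyConnected D := hCC.lineSimplyConnected
  have hzD : ∀ w, (z, w) ∉ D := fun w hw =>
    (isOpenMap_fst D hOpen).inter_frontier_eq.subset ⟨⟨(z, w), hw, rfl⟩, hz⟩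
  obtain ⟨f, hf, hfker, hfD⟩ := LineSimplyConnected.exists_functional_ne_zero
    (D := {x | (z, (0 : EuclideanSpace ℂ (Fin m))) + x ∈ D})
    (hOpen.preimage (by fun_prop))
    (by
      obtain ⟨x, hx⟩ := hConn.nonempty
      exact ⟨x - (z, 0), by simpa using hx⟩)
    (by
      intro a v
      simp only [mem_ofPred_eq, ← add_assoc]
      exact hLSC ((z, 0) + a) v)
    (W₀ := LinearMap.ker (LinearMap.fst ℂ (EuclideanSpace ℂ (Fin n)) (EuclideanSpace ℂ (Fin m))))
    (by
      rintro ⟨x, w⟩ (rfl : x = 0) h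
      exact hzD w (by simpa using h))
  obtain ⟨w, hw⟩ : ∃ w, (z, w) ∈ closure D := by
    have hcl : IsClosed (Prod.fst '' closure D) :=
      (hBdd.isCompact_closure.image continuous_fst).isClosed
    obtain ⟨⟨z', w⟩, hw, rfl⟩ := closure_minimal (image_mono subset_closure) hcl
      (frontier_subset_closure hz)
    exact ⟨w, hw⟩
  refine ⟨w, hw, fun w' hw' => ?_⟩
  by_contra hne
  obtain ⟨U, hU, hwU, hHU⟩ := hStrict (z, w)
    ⟨hw, by rw [hOpen.interior_eq]; exact hzD w⟩
  have hfz : ∀ w, f (z, w) = f (z, 0) := fun w => by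
    have := hfker (0, w) rfl
    rw [← sub_eq_zero, ← map_sub]
    simpa using this
  have hH := hHU {x | f x = f (z, 0)} ⟨f, _, hf, rfl⟩ (hfz w) (by
    refine eq_empty_of_forall_notMem ?_
    rintro x ⟨hx, hxD⟩
    refine hfD (x - (z, 0)) (by simpa using hxD) ?_
    rw [map_sub, sub_eq_zero]
    exact hx)
  have hnear : ∀ᶠ t : ℂ in 𝓝 0, (z, w) + t • ((z, w') - (z, w)) ∈ U :=
    ContinuousAt.eventually_mem (f := fun t : ℂ => (z, w) + t • ((z, w') - (z, w)))
      (by fun_prop) (hU.mem_nhds (by simpa using hwU))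
  obtain ⟨δ, hδ, hball⟩ := Metric.eventually_nhds_iff.1 hnear
  have hε : 0 < min (δ / 2) 1 := by positivity
  obtain ⟨t, ht, htD⟩ := hLSC.exists_norm_eq_mem_closure hw hw' hε.le (min_le_right _ _)
  have htU := hball (y := t) (by
    rw [dist_zero_right, ht]
    exact (min_le_left _ _).trans_lt (half_lt_self hδ))
  have hmem : (z, w) + t • ((z, w') - (z, w)) ∈ ({(z, w)} : Set _) := by
    rw [← hH]
    refine ⟨⟨htU, htD⟩, ?_⟩
    simp [hfz]
  have ht0 : t ≠ 0 := by
    rintro rfl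
    rw [norm_zero] at ht
    exact hε.ne ht
  simp [ht0, sub_eq_zero, hne] at hmem
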